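/- Let Z, H, C be finite types, let (Z, H) be a pair of random variables with joint probability mass function on Z × H, let σ : H → C be a function, and let ε ≥ 0. If I(Z; σ(H)) ≥ I(Z; H) − ε, then Σ_{h : P(H = h) > 0} P(H = h) · KL( P_{Z | H = h} ‖ P_{Z | σ(H) = σ(h)} ) ≤ ε, where P_{Z | H = h} and P_{Z | σ(H) = c} denote the conditional probability mass functions of Z given H = h and given σ(H) = c respectively. -/

import Mathlib

/-!
STATEMENT 11 (paper Proposition A.8): under the ε-approximate CPC optimality
assumption `I(Z; σ(H)) ≥ I(Z; H) − ε`, the expected KL divergence between the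
conditional law of `Z` given the history `H = h` and the conditional law of `Z`
given the representation `σ(H) = σ(h)` is at most ε.
-/

open Finset

/-- Marginal over the first coordinate: `p_Z(z) = ∑ h, p(z, h)`. -/
noncomputable def margFst {Z H : Type*} [Fintype H] (p : Z → H → ℝ) (z : Z) : ℝ :=
  ∑ h, p z h

/-- Marginal over the second coordinate: `p_H(h) = ∑ z, p(z, h)`. -/
noncomputable def margSnd {Z H : Type*} [Fintype Z] (p : Z → H → ℝ) (h : H) : ℝ :=
  ∑ z, p z h

/-- Mutual information of a joint pmf on finite types. -/
noncomputable def mutualInfo {Z H : Type*} [Fintype Z] [Fintype H] (p : Z → H → ℝ) : ℝ :=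
  ∑ z, ∑ h,
    if 0 < p z h then p z h * Real.log (p z h / (margFst p z * margSnd p h)) else 0

/-- The joint pmf of `(Z, σ(H))` induced by the joint pmf `p` of `(Z, H)`. -/
noncomputable def pushJoint {Z H C : Type*} [Fintype H] [DecidableEq C]
    (p : Z → H → ℝ) (σ : H → C) (z : Z) (c : C) : ℝ :=
  ∑ h ∈ Finset.univ.filter (fun h => σ h = c), p z h

/-- Kullback–Leibler divergence between finitely supported pmfs:
`KL(P‖Q) = ∑_{x : P(x)>0} P(x) log(P(x)/Q(x))`. -/
noncomputable def klDiv {X : Type*} [Fintype X] (P Q : X → ℝ) : ℝ :=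
  ∑ x, if 0 < P x then P x * Real.log (P x / Q x) else 0

theorem ite_pos_mul_of_nonneg {a : ℝ} (ha : 0 ≤ a) (b : ℝ) :
    (if 0 < a then a * b else 0) = a * b := by
  split_ifs with h
  · rfl
  · simp [le_antisymm (not_lt.mp h) ha]

theorem margFst_pushJoint {Z H C : Type*} [Fintype H] [Fintype C] [DecidableEq C]
    (p : Z → H → ℝ) (σ : H → C) (z : Z) : margFst (pushJoint p σ) z = margFst p z :=
  Finset.sum_fiberwise univ σ (p z)

theorem le_pushJoint {Z H C : Type*} [Fintype H] [DecidableEq C]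
    {p : Z → H → ℝ} (hnn : ∀ z h, 0 ≤ p z h) (σ : H → C) (z : Z) (h : H) :
    p z h ≤ pushJoint p σ z (σ h) :=
  Finset.single_le_sum (f := p z) (fun i _ => hnn z i) (by simp)

theorem pushJoint_nonneg {Z H C : Type*} [Fintype H] [DecidableEq C]
    {p : Z → H → ℝ} (hnn : ∀ z h, 0 ≤ p z h) (σ : H → C) (z : Z) (c : C) :
    0 ≤ pushJoint p σ z c :=
  Finset.sum_nonneg fun i _ => hnn z i

theorem le_margFst {Z H : Type*} [Fintype H] {p : Z → H → ℝ}
    (hnn : ∀ z h, 0 ≤ p z h) (z : Z) (h : H) : p z h ≤ margFst p z :=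
  Finset.single_le_sum (f := p z) (fun i _ => hnn z i) (mem_univ h)

theorem le_margSnd {Z H : Type*} [Fintype Z] {p : Z → H → ℝ}
    (hnn : ∀ z h, 0 ≤ p z h) (z : Z) (h : H) : p z h ≤ margSnd p h :=
  Finset.single_le_sum (f := fun z => p z h) (fun i _ => hnn i h) (mem_univ z)

theorem mutualInfo_eq_sum {Z H : Type*} [Fintype Z] [Fintype H] {p : Z → H → ℝ}
    (hnn : ∀ z h, 0 ≤ p z h) :
    mutualInfo p = ∑ z, ∑ h, p z h * Real.log (p z h / (margFst p z * margSnd p h)) :=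
  Finset.sum_congr rfl fun z _ => Finset.sum_congr rfl fun h _ =>
    ite_pos_mul_of_nonneg (hnn z h) _

theorem mutualInfo_pushJoint {Z H C : Type*} [Fintype Z] [Fintype H] [Fintype C] [DecidableEq C]
    {p : Z → H → ℝ} (hnn : ∀ z h, 0 ≤ p z h) (σ : H → C) :
    mutualInfo (pushJoint p σ) = ∑ z, ∑ h, p z h * Real.log
      (pushJoint p σ z (σ h) / (margFst p z * margSnd (pushJoint p σ) (σ h))) := by
  rw [mutualInfo_eq_sum (pushJoint_nonneg hnn σ)]
  refine Finset.sum_congr rfl fun z _ => ?_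
  rw [← Finset.sum_fiberwise univ σ]
  refine Finset.sum_congr rfl fun c _ => ?_
  rw [margFst_pushJoint]
  conv_lhs => arg 1; rw [pushJoint]
  rw [Finset.sum_mul]
  refine Finset.sum_congr rfl fun h hh => ?_
  rw [(Finset.mem_filter.mp hh).2]

theorem margSnd_mul_klDiv {Z H : Type*} [Fintype Z] {p : Z → H → ℝ}
    (hnn : ∀ z h, 0 ≤ p z h) (h : H) (Q : Z → ℝ) :
    (if 0 < margSnd p h then margSnd p h * klDiv (fun z => p z h / margSnd p h) Q else 0) =
      ∑ z, p z h * Real.log (p z h / margSnd p h / Q z) := by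
  have hm : 0 ≤ margSnd p h := Finset.sum_nonneg fun z _ => hnn z h
  rw [ite_pos_mul_of_nonneg hm, klDiv, Finset.mul_sum]
  refine Finset.sum_congr rfl fun z _ => ?_
  rw [ite_pos_mul_of_nonneg (div_nonneg (hnn z h) hm), ← mul_assoc]
  congr 1
  refine mul_div_cancel_of_imp' fun h0 => ?_
  exact le_antisymm (h0 ▸ le_margSnd hnn z h) (hnn z h)

/-- The expected divergence is exactly the mutual information lost by passing to `σ(H)`. -/
theorem expected_klDiv_eq_mutualInfo_sub {Z H C : Type*}
    [Fintype Z] [Fintype H] [Fintype C] [DecidableEq C]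
    {p : Z → H → ℝ} (hnn : ∀ z h, 0 ≤ p z h) (σ : H → C) :
    (∑ h, if 0 < margSnd p h then
        margSnd p h * klDiv (fun z => p z h / margSnd p h)
          (fun z => pushJoint p σ z (σ h) / margSnd (pushJoint p σ) (σ h))
      else 0) = mutualInfo p - mutualInfo (pushJoint p σ) := by
  simp_rw [margSnd_mul_klDiv hnn]
  rw [mutualInfo_eq_sum hnn, mutualInfo_pushJoint hnn, Finset.sum_comm, ← Finset.sum_sub_distrib]
  refine Finset.sum_congr rfl fun z _ => ?_
  rw [← Finset.sum_sub_distrib]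
  refine Finset.sum_congr rfl fun h _ => ?_
  rcases (hnn z h).eq_or_lt with h0 | hp
  · simp [← h0]
  have hP := hp.trans_le (le_pushJoint hnn σ z h)
  have hf := hp.trans_le (le_margFst hnn z h)
  have hm := hp.trans_le (le_margSnd hnn z h)
  have hM := hP.trans_le (le_margSnd (pushJoint_nonneg hnn σ) z (σ h))
  rw [← mul_sub, ← Real.log_div (by positivity) (by positivity)]
  congr 2
  field_simp

/-- If `I(Z; σ(H)) ≥ I(Z; H) − ε` then
`∑_{h : P(H=h)>0} P(H=h) · KL( P_{Z|H=h} ‖ P_{Z|σ(H)=σ(h)} ) ≤ ε`. -/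
theorem expected_klDiv_le_of_mutualInfo_ge {Z H C : Type*}
    [Fintype Z] [Fintype H] [Fintype C] [DecidableEq C]
    (p : Z → H → ℝ) (σ : H → C) (ε : ℝ) (hε : 0 ≤ ε)
    (hnn : ∀ z h, 0 ≤ p z h) (hsum : ∑ z, ∑ h, p z h = 1)
    (hMI : mutualInfo p - ε ≤ mutualInfo (pushJoint p σ)) :
    (∑ h, if 0 < margSnd p h then
        margSnd p h * klDiv (fun z => p z h / margSnd p h)
          (fun z => pushJoint p σ z (σ h) / margSnd (pushJoint p σ) (σ h))
      else 0) ≤ ε := by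
  rw [expected_klDiv_eq_mutualInfo_sub hnn]
  linarith
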